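/- Brouwer's fixed point theorem: every continuous function f from a nonempty compact convex subset K of ℝ^d to itself has a fixed point, i.e., there exists x ∈ K with f(x) = x. -/

import Mathlib

/-! Scarf combinatorial lemma -/

/-- `s` is dominant: no `y` exceeds the minimum of `s` in every order. -/
def Scarf.Dom {I X : Type} (r : I → X → ℕ) (s : Finset X) : Prop :=
  ∀ y, ∃ i, ∀ x ∈ s, r i y ≤ r i x

set_option linter.unusedSectionVars false

namespace Scarf

variable {I X : Type} [Fintype I] [DecidableEq I] [Fintype X] [DecidableEq X]

/-- minimizers -/
theorem exists_min (r : I → X → ℕ) (t : Finset X) (ht : t.Nonempty) :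
    ∃ m : I → X, (∀ i, m i ∈ t) ∧ ∀ i, ∀ x ∈ t, r i (m i) ≤ r i x := by
  have h : ∀ i, ∃ a ∈ t, ∀ x ∈ t, r i a ≤ r i x := fun i =>
    Finset.exists_min_image t (r i) ht
  choose m hm using h
  exact ⟨m, fun i => (hm i).1, fun i => (hm i).2⟩

theorem min_surj (r : I → X → ℕ) (hr : ∀ i, Function.Injective (r i)) (t : Finset X)
    (hd : Dom r t) (m : I → X) (hm : ∀ i, m i ∈ t) (hm' : ∀ i, ∀ x ∈ t, r i (m i) ≤ r i x) :
    ∀ y ∈ t, ∃ i, m i = y := by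
  intro y hy
  obtain ⟨i, hi⟩ := hd y
  exact ⟨i, hr i (le_antisymm (hm' i y hy) (hi _ (hm i)))⟩

theorem Dom.mono {r : I → X → ℕ} {s t : Finset X} (h : Dom r s) (hts : t ⊆ s) : Dom r t := by
  intro y
  obtain ⟨i, hi⟩ := h y
  exact ⟨i, fun x hx => hi x (hts hx)⟩

/-- The structure of a door. -/
theorem door_pair (r : I → X → ℕ) (hr : ∀ i, Function.Injective (r i)) (t : Finset X)
    (hd : Dom r t) (hc : t.card + 1 = Fintype.card I)
    (m : I → X) (hm : ∀ i, m i ∈ t) (hm' : ∀ i, ∀ x ∈ t, r i (m i) ≤ r i x) :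
    ∃ i j, i ≠ j ∧ m i = m j ∧ (∀ y ∈ t, ∃ l, l ≠ i ∧ m l = y) ∧
      (∀ y ∈ t, ∃ l, l ≠ j ∧ m l = y) := by
  have hs := min_surj r hr t hd m hm hm'
  obtain ⟨i, -, j, -, hij, he⟩ := Finset.exists_ne_map_eq_of_card_lt_of_maps_to
    (s := (Finset.univ : Finset I)) (t := t) (f := m) (by rw [Finset.card_univ]; omega)
    (fun i _ => hm i)
  refine ⟨i, j, hij, he, ?_, ?_⟩
  · intro y hy
    obtain ⟨l, hl⟩ := hs y hy
    by_cases h : l = i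
    · exact ⟨j, hij.symm, by rw [← he, ← h, hl]⟩
    · exact ⟨l, h, hl⟩
  · intro y hy
    obtain ⟨l, hl⟩ := hs y hy
    by_cases h : l = j
    · exact ⟨i, hij, by rw [he, ← h, hl]⟩
    · exact ⟨l, h, hl⟩

/-- the rooms adjacent to a door -/
theorem room_iff (r : I → X → ℕ) (hr : ∀ i, Function.Injective (r i)) (t : Finset X)
    (hd : Dom r t) (hc : t.card + 1 = Fintype.card I)
    (m : I → X) (hm : ∀ i, m i ∈ t) (hm' : ∀ i, ∀ x ∈ t, r i (m i) ≤ r i x)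
    (i j : I) (hij : i ≠ j) (he : m i = m j) (hi : ∀ y ∈ t, ∃ l, l ≠ i ∧ m l = y)
    (hj : ∀ y ∈ t, ∃ l, l ≠ j ∧ m l = y) (x : X) :
    (x ∉ t ∧ Dom r (insert x t)) ↔ ∃ k, (k = i ∨ k = j) ∧ (∀ l, l ≠ k → r l (m l) < r l x) ∧
      ∀ y, (∀ l, l ≠ k → r l (m l) < r l y) → r k y ≤ r k x := by
  constructor
  · rintro ⟨hx, hD⟩
    obtain ⟨m', h1, h2⟩ := exists_min r (insert x t) (Finset.insert_nonempty _ _)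
    have hs := min_surj r hr _ hD m' h1 h2
    have hinj : Function.Injective m' := by
      have : Set.InjOn m' (Finset.univ : Finset I) := by
        apply Finset.injOn_of_surjOn_of_card_le (t := insert x t)
        · intro a _; exact h1 a
        · intro y hy
          obtain ⟨l, hl⟩ := hs y hy
          exact ⟨l, by simp, hl⟩
        · rw [Finset.card_insert_of_notMem hx, Finset.card_univ]; omega
      intro a b hab
      exact this (by simp) (by simp) hab
    obtain ⟨k, hk⟩ := hs x (Finset.mem_insert_self _ _)
    have hmm : ∀ l, l ≠ k → m' l = m l := by
      intro l hl
      have : m' l ∈ t := by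
        have := h1 l
        rw [Finset.mem_insert] at this
        rcases this with h | h
        · exact absurd (hinj (h.trans hk.symm)) hl
        · exact h
      exact hr l (le_antisymm (h2 l _ (Finset.mem_insert_of_mem (hm l))) (hm' l _ this))
    have hlt : ∀ l, l ≠ k → r l (m l) < r l x := by
      intro l hl
      refine lt_of_le_of_ne ?_ ?_
      · rw [← hmm l hl]; exact h2 l x (Finset.mem_insert_self _ _)
      · intro h
        exact hx (hr l h ▸ hm l)
    refine ⟨k, ?_, hlt, ?_⟩
    · by_contra hcon
      push Not at hcon
      apply hij
      apply hinj
      rw [hmm i hcon.1.symm, hmm j hcon.2.symm, he]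
    · intro y hy
      obtain ⟨l, hl⟩ := hD y
      by_cases hlk : l = k
      · subst hlk; exact hl x (Finset.mem_insert_self _ _)
      · have := hl (m l) (Finset.mem_insert_of_mem (hm l))
        have := hy l hlk
        omega
  · rintro ⟨k, hk, hA, hmax⟩
    have hsk : ∀ y ∈ t, ∃ l, l ≠ k ∧ m l = y := by
      rcases hk with rfl | rfl <;> assumption
    refine ⟨?_, ?_⟩
    · intro hx
      obtain ⟨l, hl, rfl⟩ := hsk x hx
      exact lt_irrefl _ (hA l hl)
    · intro y
      by_cases hy : ∀ l, l ≠ k → r l (m l) < r l y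
      · obtain ⟨l, hl⟩ := hd y
        have hlk : l = k := by
          by_contra h
          have := hy l h
          have := hl (m l) (hm l)
          omega
        subst hlk
        refine ⟨l, ?_⟩
        intro z hz
        rw [Finset.mem_insert] at hz
        rcases hz with rfl | hz
        · exact hmax y hy
        · exact hl z hz
      · push Not at hy
        obtain ⟨l, hl, hle⟩ := hy
        refine ⟨l, ?_⟩
        intro z hz
        rw [Finset.mem_insert] at hz
        rcases hz with rfl | hz
        · exact hle.trans (hA l hl).le
        · exact hle.trans (hm' l z hz)

open Classical in
/-- An inner door is adjacent to exactly two rooms. -/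
theorem door_card_two (r : I → X → ℕ) (hr : ∀ i, Function.Injective (r i)) (t : Finset X)
    (hd : Dom r t) (hc : t.card + 1 = Fintype.card I) (z : X) (hz : z ∈ t)
    (b : I → X) (hb : ∀ k l, l ≠ k → r l z < r l (b k)) :
    (Finset.univ.filter (fun x => x ∉ t ∧ Dom r (insert x t))).card = 2 := by
  obtain ⟨m, hm, hm'⟩ := exists_min r t ⟨z, hz⟩
  obtain ⟨i, j, hij, he, hi, hj⟩ := door_pair r hr t hd hc m hm hm'
  have key := room_iff r hr t hd hc m hm hm' i j hij he hi hj
  have hex : ∀ k, ∃ x, (∀ l, l ≠ k → r l (m l) < r l x) ∧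
      ∀ y, (∀ l, l ≠ k → r l (m l) < r l y) → r k y ≤ r k x := by
    intro k
    obtain ⟨x, hx, hx'⟩ := Finset.exists_max_image
      (Finset.univ.filter (fun y => ∀ l, l ≠ k → r l (m l) < r l y)) (r k)
      ⟨b k, by
        simp only [Finset.mem_filter, Finset.mem_univ, true_and]
        intro l hl
        exact lt_of_le_of_lt (hm' l z hz) (hb k l hl)⟩
    simp only [Finset.mem_filter, Finset.mem_univ, true_and] at hx hx'
    exact ⟨x, hx, hx'⟩
  choose a ha ha' using hex
  rw [Finset.card_eq_two]
  refine ⟨a i, a j, ?_, ?_⟩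
  · intro h
    obtain ⟨l, hl⟩ := hd (a i)
    have h1 := hl (m l) (hm l)
    by_cases hli : l = i
    · subst hli
      have := ha j l hij
      rw [← h] at this
      omega
    · have := ha i l hli
      omega
  · ext x
    simp only [Finset.mem_filter, Finset.mem_univ, true_and, Finset.mem_insert,
      Finset.mem_singleton]
    rw [key]
    constructor
    · rintro ⟨k, hk, h1, h2⟩
      have : x = a k := hr k (le_antisymm (ha' k x h1) (h2 _ (ha k)))
      rcases hk with rfl | rfl
      · exact Or.inl this
      · exact Or.inr this
    · rintro (rfl | rfl)
      · exact ⟨i, Or.inl rfl, ha i, ha' i⟩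
      · exact ⟨j, Or.inr rfl, ha j, ha' j⟩

open Classical in
/-- A non-colourful set has an even number of `i₀`-doors. -/
theorem room_even (c : X → I) (i₀ : I) (s : Finset X) (hs : s.card = Fintype.card I)
    (hn : s.image c ≠ Finset.univ) :
    Even (s.filter (fun x => (s.erase x).image c = Finset.univ.erase i₀)).card := by
  by_cases hE : (s.filter (fun x => (s.erase x).image c = Finset.univ.erase i₀)) = ∅
  · rw [hE]; simp
  obtain ⟨x0, hx0⟩ := Finset.nonempty_iff_ne_empty.mpr hE
  rw [Finset.mem_filter] at hx0
  obtain ⟨h0, h1⟩ := hx0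
  have hinj : Set.InjOn c (s.erase x0) := by
    apply Finset.injOn_of_card_image_eq
    rw [h1, Finset.card_erase_of_mem (Finset.mem_univ _), Finset.card_erase_of_mem h0, hs,
      Finset.card_univ]
  have hc0 : c x0 ≠ i₀ := by
    intro h
    apply hn
    rw [← Finset.insert_erase h0, Finset.image_insert, h1, h]
    exact Finset.insert_erase (Finset.mem_univ _)
  have hmem : ∀ k, k ≠ i₀ → ∃ x, x ≠ x0 ∧ x ∈ s ∧ c x = k := by
    intro k hk
    have : k ∈ (s.erase x0).image c := by rw [h1]; simp [hk]
    simp only [Finset.mem_image, Finset.mem_erase] at this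
    obtain ⟨x, ⟨h, h'⟩, h''⟩ := this
    exact ⟨x, h, h', h''⟩
  have hne : ∀ x ∈ s, c x ≠ i₀ := by
    intro x hx
    by_cases h : x = x0
    · rw [h]; exact hc0
    · have : c x ∈ (s.erase x0).image c := Finset.mem_image_of_mem _ (by simp [h, hx])
      rw [h1] at this
      simpa using this
  obtain ⟨x1, h10, h1s, hcx⟩ := hmem (c x0) hc0
  have : (s.filter (fun x => (s.erase x).image c = Finset.univ.erase i₀)) = {x0, x1} := by
    ext x
    simp only [Finset.mem_filter, Finset.mem_insert, Finset.mem_singleton]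
    constructor
    · rintro ⟨hx, hx'⟩
      by_contra hcon
      push Not at hcon
      have : c x ∈ (s.erase x).image c := by rw [hx']; simp [hne x hx]
      simp only [Finset.mem_image, Finset.mem_erase] at this
      obtain ⟨x', ⟨hxx, hxs⟩, hcc⟩ := this
      by_cases h : x' = x0
      · subst h
        exact hcon.2 (hinj (by simp [hcon.1, hx]) (by simp [h10, h1s]) (by rw [hcx, hcc]))
      · exact hxx (hinj (by simp [h, hxs]) (by simp [hcon.1, hx]) hcc)
    · rintro (rfl | rfl)
      · exact ⟨h0, h1⟩
      · refine ⟨h1s, ?_⟩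
        ext k
        simp only [Finset.mem_image, Finset.mem_erase, Finset.mem_univ, and_true]
        constructor
        · rintro ⟨x', ⟨_, hxs⟩, rfl⟩
          exact hne _ hxs
        · intro hk
          by_cases hkk : k = c x0
          · exact ⟨x0, ⟨h10.symm, h0⟩, hkk.symm⟩
          · obtain ⟨x', _, h', h''⟩ := hmem k hk
            refine ⟨x', ⟨?_, h'⟩, h''⟩
            rintro rfl
            exact hkk (h''.symm.trans hcx)
  rw [this, Finset.card_pair h10.symm]
  exact even_two

open Classical in
/-- Abstract parity argument. -/
theorem colourful_of_doors (r : I → X → ℕ) (c : X → I) (i₀ : I) (t₀ : Finset X)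
    (hd0 : Dom r t₀) (ht0 : t₀.card + 1 = Fintype.card I)
    (hc0 : t₀.image c = Finset.univ.erase i₀)
    (h1 : (Finset.univ.filter (fun x => x ∉ t₀ ∧ Dom r (insert x t₀))).card = 1)
    (h2 : ∀ t : Finset X, Dom r t → t.card + 1 = Fintype.card I →
      t.image c = Finset.univ.erase i₀ → t ≠ t₀ →
      (Finset.univ.filter (fun x => x ∉ t ∧ Dom r (insert x t))).card = 2) :
    ∃ s : Finset X, Dom r s ∧ s.card = Fintype.card I ∧ s.image c = Finset.univ := by
  by_contra hcon
  push Not at hcon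
  set R : Finset (Finset X) :=
    Finset.univ.filter (fun s => Dom r s ∧ s.card = Fintype.card I) with hR
  set D : Finset (Finset X) :=
    Finset.univ.filter (fun t => Dom r t ∧ t.card + 1 = Fintype.card I ∧
      t.image c = Finset.univ.erase i₀) with hD
  have hdc := Finset.sum_card_bipartiteAbove_eq_sum_card_bipartiteBelow
    (s := D) (t := R) (fun t s => t ⊆ s)
  have hA : ∀ t ∈ D, (Finset.bipartiteAbove (fun t s => t ⊆ s) R t).card =
      (Finset.univ.filter (fun x => x ∉ t ∧ Dom r (insert x t))).card := by
    intro t ht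
    simp only [hD, Finset.mem_filter, Finset.mem_univ, true_and] at ht
    symm
    apply Finset.card_bij (fun x _ => insert x t)
    · intro x hx
      simp only [Finset.mem_filter, Finset.mem_univ, true_and] at hx
      simp only [Finset.mem_bipartiteAbove, hR, Finset.mem_filter, Finset.mem_univ, true_and]
      exact ⟨⟨hx.2, by rw [Finset.card_insert_of_notMem hx.1]; exact ht.2.1⟩,
        Finset.subset_insert _ _⟩
    · intro x hx y hy hxy
      simp only [Finset.mem_filter, Finset.mem_univ, true_and] at hx
      have : x ∈ insert y t := hxy ▸ Finset.mem_insert_self x t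
      rw [Finset.mem_insert] at this
      exact this.resolve_right hx.1
    · intro s hs
      simp only [Finset.mem_bipartiteAbove, hR, Finset.mem_filter, Finset.mem_univ,
        true_and] at hs
      have h3 : (s \ t).card = 1 := by
        rw [Finset.card_sdiff_of_subset hs.2]; omega
      obtain ⟨x, hx⟩ := Finset.card_eq_one.mp h3
      have hx' : x ∈ s \ t := by rw [hx]; simp
      rw [Finset.mem_sdiff] at hx'
      have he : insert x t = s := by
        rw [Finset.insert_eq, ← hx]
        exact Finset.sdiff_union_of_subset hs.2
      refine ⟨x, ?_, he⟩
      simp only [Finset.mem_filter, Finset.mem_univ, true_and]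
      exact ⟨hx'.2, he ▸ hs.1.1⟩
  have hB : ∀ s ∈ R, Even (Finset.bipartiteBelow (fun t s => t ⊆ s) D s).card := by
    intro s hs
    simp only [hR, Finset.mem_filter, Finset.mem_univ, true_and] at hs
    have := room_even c i₀ s hs.2 (hcon s hs.1 hs.2)
    convert this using 1
    symm
    apply Finset.card_bij (fun x _ => s.erase x)
    · intro x hx
      simp only [Finset.mem_filter] at hx
      simp only [Finset.mem_bipartiteBelow, hD, Finset.mem_filter, Finset.mem_univ, true_and]
      exact ⟨⟨hs.1.mono (Finset.erase_subset _ _),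
        by rw [Finset.card_erase_add_one hx.1]; exact hs.2, hx.2⟩, Finset.erase_subset _ _⟩
    · intro x hx y hy hxy
      simp only [Finset.mem_filter] at hx
      exact Finset.erase_injOn s hx.1 (Finset.mem_filter.mp hy).1 hxy
    · intro t ht
      simp only [Finset.mem_bipartiteBelow, hD, Finset.mem_filter, Finset.mem_univ,
        true_and] at ht
      have h3 : (s \ t).card = 1 := by
        rw [Finset.card_sdiff_of_subset ht.2]; omega
      obtain ⟨x, hx⟩ := Finset.card_eq_one.mp h3
      have hx' : x ∈ s \ t := by rw [hx]; simp
      rw [Finset.mem_sdiff] at hx'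
      have he : s.erase x = t := by
        rw [Finset.erase_eq, ← hx]
        exact Finset.sdiff_sdiff_eq_self ht.2
      refine ⟨x, ?_, he⟩
      simp only [Finset.mem_filter]
      exact ⟨hx'.1, he ▸ ht.1.2.2⟩
  have ht0D : t₀ ∈ D := by
    simp only [hD, Finset.mem_filter, Finset.mem_univ, true_and]
    exact ⟨hd0, ht0, hc0⟩
  have hE : Even (∑ s ∈ R, (Finset.bipartiteBelow (fun t s => t ⊆ s) D s).card) :=
    Finset.even_sum _ hB
  rw [← hdc, ← Finset.add_sum_erase _ _ ht0D, hA _ ht0D, h1] at hE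
  have hE2 : Even (∑ t ∈ D.erase t₀, (Finset.bipartiteAbove (fun t s => t ⊆ s) R t).card) := by
    apply Finset.even_sum
    intro t ht
    rw [Finset.mem_erase] at ht
    rw [hA t ht.2]
    have h3 := ht.2
    simp only [hD, Finset.mem_filter, Finset.mem_univ, true_and] at h3
    rw [h2 t h3.1 h3.2.1 h3.2.2 ht.1]
    exact even_two
  rw [Nat.even_add] at hE
  exact absurd (hE.mpr hE2) (by decide)

end Scarf

namespace Scarf

variable {I T : Type} [Fintype I] [DecidableEq I] [Fintype T] [DecidableEq T]

open Classical in
theorem scarf [Nonempty T] (hI : 2 ≤ Fintype.card I) (r : I → T → ℕ)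
    (hr : ∀ i, Function.Injective (r i)) (c : T → I) :
    ∃ (σ : Finset T) (C : Finset I), (∀ y, ∃ i ∈ C, ∀ x ∈ σ, r i y ≤ r i x) ∧
      ∀ i ∈ C, ∃ x ∈ σ, c x = i := by
  obtain ⟨M, hM⟩ : ∃ M : ℕ, ∀ i x, r i x + 1 < M := by
    refine ⟨(∑ i, ∑ x, r i x) + 2, fun i x => ?_⟩
    have h1 : r i x ≤ ∑ x, r i x :=
      Finset.single_le_sum (f := fun x => r i x) (fun _ _ => Nat.zero_le _) (Finset.mem_univ x)
    have h2 : ∑ x, r i x ≤ ∑ i, ∑ x, r i x :=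
      Finset.single_le_sum (f := fun i => ∑ x, r i x) (fun _ _ => Nat.zero_le _)
        (Finset.mem_univ i)
    omega
  let e := Fintype.equivFin I
  let R : I → T ⊕ I → ℕ := fun i => Sum.elim (fun x => r i x + 1)
    (fun k => if k = i then 0 else M + (e k : ℕ))
  have R1 : ∀ i x, R i (Sum.inl x) = r i x + 1 := fun i x => rfl
  have R2 : ∀ i, R i (Sum.inr i) = 0 := fun i => by simp [R]
  have R3 : ∀ i k, k ≠ i → R i (Sum.inr k) = M + (e k : ℕ) := fun i k h => by simp [R, h]
  have hR : ∀ i, Function.Injective (R i) := by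
    intro i a b hab
    rcases a with a | a <;> rcases b with b | b
    · rw [R1, R1] at hab
      rw [hr i (by omega : r i a = r i b)]
    · by_cases h : b = i
      · subst h; rw [R1, R2] at hab; omega
      · rw [R1, R3 i b h] at hab; have := hM i a; omega
    · by_cases h : a = i
      · subst h; rw [R1, R2] at hab; omega
      · rw [R1, R3 i a h] at hab; have := hM i b; omega
    · by_cases h : a = i <;> by_cases h' : b = i
      · rw [h, h']
      · subst h; rw [R2, R3 _ _ h'] at hab; have := hM a (Classical.arbitrary T); omega
      · subst h'; rw [R2, R3 _ _ h] at hab; have := hM b (Classical.arbitrary T); omega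
      · rw [R3 _ _ h, R3 _ _ h'] at hab
        have : e a = e b := Fin.ext (by omega)
        rw [e.injective this]
  let c' : T ⊕ I → I := Sum.elim c id
  obtain ⟨i₀⟩ : Nonempty I := Fintype.card_pos_iff.mp (by omega)
  let t₀ : Finset (T ⊕ I) := (Finset.univ.erase i₀).image Sum.inr
  have ht0 : ∀ x, x ∈ t₀ ↔ ∃ k, k ≠ i₀ ∧ Sum.inr k = x := by
    intro x; simp [t₀]
  obtain ⟨z, -, hz⟩ := Finset.exists_max_image (Finset.univ : Finset T) (r i₀)
    Finset.univ_nonempty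
  suffices hmain : ∃ s : Finset (T ⊕ I), Dom R s ∧ s.card = Fintype.card I ∧
      s.image c' = Finset.univ by
    obtain ⟨s, hs, hsc, hsi⟩ := hmain
    refine ⟨Finset.univ.filter (fun x => Sum.inl x ∈ s),
      Finset.univ.filter (fun i => Sum.inr i ∉ s), ?_, ?_⟩
    · intro y
      obtain ⟨i, hi⟩ := hs (Sum.inl y)
      refine ⟨i, ?_, ?_⟩
      · simp only [Finset.mem_filter, Finset.mem_univ, true_and]
        intro h
        have := hi _ h
        rw [R1, R2] at this
        omega
      · intro x hx
        simp only [Finset.mem_filter, Finset.mem_univ, true_and] at hx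
        have := hi _ hx
        rw [R1, R1] at this
        omega
    · intro i hi
      simp only [Finset.mem_filter, Finset.mem_univ, true_and] at hi ⊢
      have : i ∈ s.image c' := by rw [hsi]; simp
      rw [Finset.mem_image] at this
      obtain ⟨x, hx, hxi⟩ := this
      rcases x with x | x
      · exact ⟨x, hx, hxi⟩
      · have : x = i := hxi
        subst this
        exact absurd hx hi
  refine colourful_of_doors R c' i₀ t₀ ?_ ?_ ?_ ?_ ?_
  · intro y
    rcases y with y | y
    · refine ⟨i₀, fun x hx => ?_⟩
      obtain ⟨k, hk, rfl⟩ := (ht0 x).mp hx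
      rw [R1, R3 _ _ hk]
      have := hM i₀ y
      omega
    · exact ⟨y, fun x _ => by rw [R2]; omega⟩
  · have : t₀.card = Fintype.card I - 1 := by
      rw [Finset.card_image_of_injective _ Sum.inr_injective,
        Finset.card_erase_of_mem (Finset.mem_univ _), Finset.card_univ]
    omega
  · simp only [t₀, Finset.image_image]
    have : c' ∘ Sum.inr = id := rfl
    rw [this, Finset.image_id]
  · rw [Finset.card_eq_one]
    refine ⟨Sum.inl z, ?_⟩
    ext x
    simp only [Finset.mem_filter, Finset.mem_univ, true_and, Finset.mem_singleton]
    constructor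
    · rintro ⟨hx, hd⟩
      rcases x with x | x
      · obtain ⟨i, hi⟩ := hd (Sum.inl z)
        have hii : i = i₀ := by
          by_contra h
          have := hi (Sum.inr i) (Finset.mem_insert_of_mem ((ht0 _).mpr ⟨i, h, rfl⟩))
          rw [R1, R2] at this
          omega
        subst hii
        have := hi _ (Finset.mem_insert_self _ _)
        rw [R1, R1] at this
        rw [hr i (le_antisymm (hz x (Finset.mem_univ _)) (by omega))]
      · exfalso
        have hxx : x = i₀ := by
          by_contra h
          exact hx ((ht0 _).mpr ⟨x, h, rfl⟩)
        subst hxx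
        obtain ⟨i, hi⟩ := hd (Sum.inl z)
        have : Sum.inr i ∈ insert (Sum.inr x) t₀ := by
          by_cases h : i = x
          · rw [h]; exact Finset.mem_insert_self _ _
          · exact Finset.mem_insert_of_mem ((ht0 _).mpr ⟨i, h, rfl⟩)
        have := hi _ this
        rw [R1, R2] at this
        omega
    · rintro rfl
      refine ⟨?_, ?_⟩
      · rw [ht0]; simp
      · intro y
        rcases y with y | y
        · refine ⟨i₀, fun x hx => ?_⟩
          rw [Finset.mem_insert] at hx
          rcases hx with rfl | hx
          · rw [R1, R1]
            have := hz y (Finset.mem_univ _)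
            omega
          · obtain ⟨k, hk, rfl⟩ := (ht0 x).mp hx
            rw [R1, R3 _ _ hk]
            have := hM i₀ y
            omega
        · exact ⟨y, fun x _ => by rw [R2]; omega⟩
  · intro t hd hc hi hne
    have : ∃ w, Sum.inl w ∈ t := by
      by_contra hcon
      push Not at hcon
      apply hne
      ext x
      rw [ht0]
      rcases x with x | x
      · simp [hcon x]
      · have h1 : x ∈ t.image c' ↔ Sum.inr x ∈ t := by
          rw [Finset.mem_image]
          constructor
          · rintro ⟨a, ha, hax⟩
            rcases a with a | a
            · exact absurd ha (hcon a)
            · have : a = x := hax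
              rw [← this]; exact ha
          · intro h; exact ⟨_, h, rfl⟩
        rw [← h1, hi]
        simp
    obtain ⟨w, hw⟩ := this
    refine door_card_two R hR t hd hc _ hw Sum.inr ?_
    intro k l hkl
    rw [R1, R3 _ _ hkl.symm]
    have := hM l w
    omega

/-- Scarf lemma on the grid of mesh `1 / N` in the simplex. -/
theorem grid (hI : 2 ≤ Fintype.card I) (N : ℕ) (c : (I → ℕ) → I) :
    ∃ (m : I → ℕ) (S : Set (I → ℕ)), S.Nonempty ∧ (∀ x ∈ S, ∑ i, x i = N) ∧
      (∀ x ∈ S, ∀ i, m i ≤ x i ∧ x i ≤ m i + Fintype.card I) ∧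
      ∀ i, m i = 0 ∨ ∃ x ∈ S, c x = i := by
  let T := {x : I → Fin (N + 1) // ∑ i, (x i : ℕ) = N}
  obtain ⟨j₀⟩ : Nonempty I := Fintype.card_pos_iff.mp (by omega)
  have mk : ∀ y : I → ℕ, ∑ i, y i = N → ∃ x : T, ∀ i, (x.1 i : ℕ) = y i := by
    intro y hy
    have hle : ∀ i, y i < N + 1 := by
      intro i
      have : y i ≤ ∑ i, y i := Finset.single_le_sum (fun _ _ => Nat.zero_le _) (Finset.mem_univ i)
      omega
    exact ⟨⟨fun i => ⟨y i, hle i⟩, hy⟩, fun i => rfl⟩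
  haveI : Nonempty T := by
    obtain ⟨x, -⟩ := mk (Pi.single j₀ N) (by simp)
    exact ⟨x⟩
  let e := Fintype.equivFin T
  obtain ⟨σ, C, h1, h2⟩ := scarf (T := T) hI
    (fun i x => (x.1 i : ℕ) * Fintype.card T + (e x : ℕ)) (by
      intro i a b hab
      have hab : (a.1 i : ℕ) * Fintype.card T + (e a : ℕ) =
        (b.1 i : ℕ) * Fintype.card T + (e b : ℕ) := hab
      have h : (e a : ℕ) = e b := by
        have := congrArg (· % Fintype.card T) hab
        simpa [Nat.mul_add_mod', Nat.mod_eq_of_lt (e a).2, Nat.mod_eq_of_lt (e b).2] using this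
      exact e.injective (Fin.ext h)) (fun x => c (fun i => (x.1 i : ℕ)))
  have h1' : ∀ y : T, ∃ i ∈ C, ∀ x ∈ σ, (y.1 i : ℕ) ≤ x.1 i := by
    intro y
    obtain ⟨i, hi, h⟩ := h1 y
    refine ⟨i, hi, fun x hx => ?_⟩
    have h3 := h x hx
    by_contra hlt
    push Not at hlt
    have h4 : ((x.1 i : ℕ) + 1) * Fintype.card T ≤ (y.1 i : ℕ) * Fintype.card T :=
      Nat.mul_le_mul_right _ hlt
    have h5 := (e x).2
    rw [add_mul, one_mul] at h4
    have h3 : (y.1 i : ℕ) * Fintype.card T + (e y : ℕ) ≤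
      (x.1 i : ℕ) * Fintype.card T + (e x : ℕ) := h3
    omega
  obtain ⟨i₁, hi₁, -⟩ := h1' (Classical.arbitrary T)
  obtain ⟨x₁, hx₁, -⟩ := h2 i₁ hi₁
  have hmin : ∀ i, ∃ x ∈ σ, ∀ y ∈ σ, (x.1 i : ℕ) ≤ y.1 i := fun i =>
    Finset.exists_min_image σ (fun x => (x.1 i : ℕ)) ⟨x₁, hx₁⟩
  choose a ha ha' using hmin
  let m : I → ℕ := fun i => if i ∈ C then ((a i).1 i : ℕ) else 0
  have hmle : ∀ x ∈ σ, ∀ i, m i ≤ (x.1 i : ℕ) := by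
    intro x hx i
    by_cases h : i ∈ C
    · simp only [m, h, if_true]; exact ha' i x hx
    · simp [m, h]
  have hsum : N < ∑ i, m i + Fintype.card I := by
    by_contra hcon
    push Not at hcon
    obtain ⟨y, hy⟩ := mk (fun i => m i + 1 +
      (Pi.single i₁ (N - (∑ i, m i + Fintype.card I)) : I → ℕ) i) (by
        simp only [Finset.sum_add_distrib, Finset.sum_pi_single']
        simp
        omega)
    obtain ⟨i, hi, h⟩ := h1' y
    have h3 := h _ (ha i)
    rw [hy] at h3
    have : m i = ((a i).1 i : ℕ) := by simp [m, hi]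
    omega
  refine ⟨m, {x | ∃ s ∈ σ, x = fun i => (s.1 i : ℕ)}, ⟨_, x₁, hx₁, rfl⟩, ?_, ?_, ?_⟩
  · rintro x ⟨s, hs, rfl⟩
    exact s.2
  · rintro x ⟨s, hs, rfl⟩ i
    refine ⟨hmle s hs i, ?_⟩
    have h3 : ∑ i, ((s.1 i : ℕ) - m i) + ∑ i, m i = N := by
      rw [← Finset.sum_add_distrib]
      refine Eq.trans ?_ s.2
      apply Finset.sum_congr rfl
      intro j _
      have := hmle s hs j
      omega
    have h4 : (s.1 i : ℕ) - m i ≤ ∑ i, ((s.1 i : ℕ) - m i) :=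
      Finset.single_le_sum (f := fun i => (s.1 i : ℕ) - m i) (fun _ _ => Nat.zero_le _)
        (Finset.mem_univ i)
    show (s.1 i : ℕ) ≤ _
    omega
  · intro i
    by_cases h : i ∈ C
    · right
      obtain ⟨x, hx, hc⟩ := h2 i h
      exact ⟨_, ⟨x, hx, rfl⟩, hc⟩
    · left; simp [m, h]

end Scarf

namespace Scarf

theorem fixed_of_approx {E : Type} [MetricSpace E] {K : Set E} (hK : IsCompact K)
    (hne : K.Nonempty) {f : E → E} (hf : ContinuousOn f K)
    (h : ∀ ε > 0, ∃ x ∈ K, dist (f x) x ≤ ε) : ∃ x ∈ K, f x = x := by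
  obtain ⟨x, hx, hmin⟩ := hK.exists_isMinOn (f := fun x => dist (f x) x) hne
    (continuous_dist.comp_continuousOn (hf.prodMk continuousOn_id))
  refine ⟨x, hx, ?_⟩
  by_contra hcon
  have hpos : 0 < dist (f x) x := dist_pos.mpr hcon
  obtain ⟨y, hy, hle⟩ := h (dist (f x) x / 2) (by linarith)
  have : dist (f x) x ≤ dist (f y) y := hmin hy
  linarith

theorem brouwer_simplex {I : Type} [Fintype I] [DecidableEq I] [Nonempty I]
    (f : (I → ℝ) → (I → ℝ)) (hf : ContinuousOn f (stdSimplex ℝ I))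
    (hm : Set.MapsTo f (stdSimplex ℝ I) (stdSimplex ℝ I)) :
    ∃ x ∈ stdSimplex ℝ I, f x = x := by
  have hK : IsCompact (stdSimplex ℝ I) := isCompact_stdSimplex ℝ I
  have hne : (stdSimplex ℝ I).Nonempty := ⟨_, single_mem_stdSimplex ℝ (Classical.arbitrary I)⟩
  by_cases hI : Fintype.card I ≤ 1
  · obtain ⟨x, hx⟩ := hne
    refine ⟨x, hx, ?_⟩
    have hss : Subsingleton I := Fintype.card_le_one_iff_subsingleton.mp hI
    have key : ∀ y ∈ stdSimplex ℝ I, ∀ i, y i = 1 := by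
      intro y hy i
      rw [← hy.2]
      exact (Fintype.sum_subsingleton _ i).symm
    funext i
    rw [key _ (hm hx), key _ hx]
  have hI2 : 2 ≤ Fintype.card I := by omega
  set n := Fintype.card I with hn
  have hnpos : (0 : ℝ) < n := by exact_mod_cast (by omega : 0 < n)
  apply fixed_of_approx hK hne hf
  intro ε hε
  -- it suffices to find a point which does not decrease much
  suffices hs : ∃ q ∈ stdSimplex ℝ I, ∀ i, q i - ε / n ≤ f q i by
    obtain ⟨q, hq, hqi⟩ := hs
    refine ⟨q, hq, ?_⟩
    rw [dist_pi_le_iff hε.le]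
    intro i
    rw [Real.dist_eq, abs_le]
    have hle : ε / n ≤ ε := by
      apply div_le_self hε.le
      exact_mod_cast (by omega : 1 ≤ n)
    refine ⟨by linarith [hqi i], ?_⟩
    have h1 : ∑ j, (f q j - q j + ε / n) = ε := by
      rw [Finset.sum_add_distrib, Finset.sum_sub_distrib, (hm hq).2, hq.2]
      simp only [sub_self, zero_add, Finset.sum_const, Finset.card_univ, nsmul_eq_mul, ← hn]
      field_simp
    have h2 : f q i - q i + ε / n ≤ ∑ j, (f q j - q j + ε / n) :=
      Finset.single_le_sum (f := fun j => f q j - q j + ε / n)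
        (fun j _ => by linarith [hqi j]) (Finset.mem_univ i)
    have : 0 < ε / n := by positivity
    linarith
  have huc := hK.uniformContinuousOn_of_continuous hf
  rw [Metric.uniformContinuousOn_iff] at huc
  have hη : 0 < ε / n / 2 := by positivity
  obtain ⟨δ, hδ, huc⟩ := huc (ε / n / 2) hη
  obtain ⟨N, hN⟩ := exists_nat_gt ((n : ℝ) / min δ (ε / n / 2))
  have hminpos : 0 < min δ (ε / n / 2) := lt_min hδ hη
  have hNpos : (0 : ℝ) < N := lt_trans (by positivity) hN
  have hnN : (n : ℝ) / N < min δ (ε / n / 2) := by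
    rw [div_lt_iff₀ hminpos] at hN
    rw [div_lt_iff₀ hNpos]
    linarith
  let p : (I → ℕ) → (I → ℝ) := fun x i => (x i : ℝ) / N
  have hp : ∀ x : I → ℕ, ∑ i, x i = N → p x ∈ stdSimplex ℝ I := by
    intro x hx
    refine ⟨fun i => by positivity, ?_⟩
    simp only [p]
    rw [← Finset.sum_div, ← Nat.cast_sum, hx]
    exact div_self hNpos.ne'
  have hcol : ∀ x : I → ℕ, ∃ i, ∑ i, x i = N → p x i ≤ f (p x) i := by
    intro x
    by_cases hx : ∑ i, x i = N
    · by_contra hcon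
      push Not at hcon
      have : ∑ i, f (p x) i < ∑ i, p x i :=
        Finset.sum_lt_sum_of_nonempty Finset.univ_nonempty (fun i _ => (hcon i).2)
      rw [(hp x hx).2, (hm (hp x hx)).2] at this
      exact lt_irrefl _ this
    · exact ⟨Classical.arbitrary I, fun h => absurd h hx⟩
  choose c hc using hcol
  obtain ⟨m, S, ⟨x₀, hx₀⟩, hS, hbd, hmc⟩ := grid hI2 N c
  have hclose : ∀ x ∈ S, ∀ y ∈ S, ∀ i, |p x i - p y i| ≤ n / N := by
    intro x hx y hy i
    simp only [p]
    rw [← sub_div, abs_div, abs_of_pos hNpos]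
    gcongr
    have h1 := hbd x hx i
    have h2 := hbd y hy i
    have a1 : (m i : ℝ) ≤ x i := by exact_mod_cast h1.1
    have a2 : (x i : ℝ) ≤ m i + n := by exact_mod_cast h1.2
    have a3 : (m i : ℝ) ≤ y i := by exact_mod_cast h2.1
    have a4 : (y i : ℝ) ≤ m i + n := by exact_mod_cast h2.2
    rw [abs_le]
    constructor <;> linarith
  refine ⟨p x₀, hp _ (hS _ hx₀), fun i => ?_⟩
  have hlt2 : (n : ℝ) / N < ε / n / 2 := lt_of_lt_of_le hnN (min_le_right _ _)
  rcases hmc i with h0 | ⟨x, hx, hci⟩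
  · have h1 := (hbd x₀ hx₀ i).2
    rw [h0, zero_add] at h1
    have h2 : p x₀ i ≤ n / N := by
      simp only [p]
      gcongr
    have h3 := (hm (hp _ (hS _ hx₀))).1 i
    linarith
  · have h1 := hc x (hS x hx)
    rw [hci] at h1
    have h2 : dist (p x) (p x₀) < δ := by
      refine lt_of_le_of_lt ?_ (lt_of_lt_of_le hnN (min_le_left _ _))
      rw [dist_pi_le_iff (by positivity)]
      intro j
      rw [Real.dist_eq]
      exact hclose x hx x₀ hx₀ j
    have h3 := lt_of_le_of_lt (dist_le_pi_dist _ _ i)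
      (huc _ (hp _ (hS _ hx)) _ (hp _ (hS _ hx₀)) h2)
    rw [Real.dist_eq, abs_lt] at h3
    have h4 := abs_le.mp (hclose x hx x₀ hx₀ i)
    linarith [h3.1, h3.2, h4.1, h4.2]

end Scarf

/-- **Brouwer's fixed point theorem**: every continuous function from a nonempty
compact convex subset `K ⊆ ℝ^d` to itself has a fixed point. -/
theorem brouwer_fixed_point (d : ℕ) (K : Set (Fin d → ℝ))
    (hne : K.Nonempty) (hcomp : IsCompact K) (hconv : Convex ℝ K)
    (f : (Fin d → ℝ) → (Fin d → ℝ)) (hf : ContinuousOn f K)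
    (hmaps : Set.MapsTo f K K) :
    ∃ x ∈ K, f x = x := by
  classical
  apply Scarf.fixed_of_approx hcomp hne hf
  intro ε hε
  obtain ⟨t, htK, htf, hcov⟩ := hcomp.finite_cover_balls hε
  haveI : Fintype t := htf.fintype
  haveI : Nonempty t := by
    obtain ⟨x, hx⟩ := hne
    have := hcov hx
    simp only [Set.mem_iUnion] at this
    obtain ⟨y, hy, -⟩ := this
    exact ⟨⟨y, hy⟩⟩
  let w : t → (Fin d → ℝ) → ℝ := fun j y => max 0 (ε - dist y j.1)
  have hw0 : ∀ j y, 0 ≤ w j y := fun j y => le_max_left _ _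
  have hwc : ∀ j, Continuous (w j) := fun j => by
    simp only [w]; fun_prop
  have hwpos : ∀ y ∈ K, 0 < ∑ j, w j y := by
    intro y hy
    have := hcov hy
    simp only [Set.mem_iUnion] at this
    obtain ⟨z, hz, hyz⟩ := this
    refine Finset.sum_pos' (fun j _ => hw0 j y) ⟨⟨z, hz⟩, Finset.mem_univ _, ?_⟩
    rw [Metric.mem_ball] at hyz
    exact lt_max_of_lt_right (by simpa using hyz)
  let g : (t → ℝ) → (Fin d → ℝ) := fun s => ∑ j, s j • j.1
  have hgc : Continuous g := by simp only [g]; fun_prop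
  have hgK : ∀ s ∈ stdSimplex ℝ t, g s ∈ K := by
    intro s hs
    exact hconv.sum_mem (fun j _ => hs.1 j) hs.2 (fun j _ => htK j.2)
  let L : (Fin d → ℝ) → (t → ℝ) := fun y j => w j y / ∑ k, w k y
  have hL : ∀ y ∈ K, L y ∈ stdSimplex ℝ t := by
    intro y hy
    refine ⟨fun j => div_nonneg (hw0 j y) (hwpos y hy).le, ?_⟩
    simp only [L]
    rw [← Finset.sum_div]
    exact div_self (hwpos y hy).ne'
  have hLc : ContinuousOn L K := by
    rw [continuousOn_pi]
    intro j
    refine ContinuousOn.div (hwc j).continuousOn ?_ (fun y hy => (hwpos y hy).ne')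
    exact (continuous_finsetSum _ (fun k _ => hwc k)).continuousOn
  obtain ⟨s, hs, hfix⟩ := Scarf.brouwer_simplex (fun s => L (f (g s)))
    (hLc.comp (hf.comp hgc.continuousOn hgK) (fun s hs => hmaps (hgK s hs)))
    (fun s hs => hL _ (hmaps (hgK s hs)))
  refine ⟨g s, hgK s hs, ?_⟩
  have hy := hmaps (hgK s hs)
  have hfix : L (f (g s)) = s := hfix
  set y := f (g s) with hydef
  have hsum : g s - y = ∑ j, s j • (j.1 - y) := by
    simp only [smul_sub, Finset.sum_sub_distrib, g]
    rw [← Finset.sum_smul, hs.2, one_smul]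
  rw [dist_comm, dist_eq_norm, hsum]
  calc ‖∑ j, s j • (j.1 - y)‖ ≤ ∑ j, ‖s j • (j.1 - y)‖ := norm_sum_le _ _
    _ ≤ ∑ j, s j * ε := by
      apply Finset.sum_le_sum
      intro j _
      rw [norm_smul, Real.norm_of_nonneg (hs.1 j)]
      by_cases h : dist y j.1 ≤ ε
      · apply mul_le_mul_of_nonneg_left _ (hs.1 j)
        rw [← dist_eq_norm, dist_comm]
        exact h
      · have : s j = 0 := by
          rw [← hfix]
          have : w j y = 0 := max_eq_left (by linarith)
          simp [L, this]
        simp [this]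
    _ = ε := by rw [← Finset.sum_mul, hs.2, one_mul]
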